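/- arXiv:2109.01632 — 4 statements merged into one kernel-verified Lean document; each statement's English description precedes it below -/
import Mathlib

section
/- Fix a real n×m matrix Y and a symmetric matrix λ ∈ ℝ^{r×r}, and define the Lagrangian L : ℝ^{n×r} → ℝ by L(U) = −(1/2) Tr(Yᵀ U Uᵀ Y) + (1/2) Tr(λ (Uᵀ U − I_r)). Then L is twice differentiable and for every U and every direction ξ ∈ ℝ^{n×r}, the second derivative of L at U evaluated at (ξ, ξ) equals ⟨ξ, −Y Yᵀ ξ + ξ λ⟩, i.e. the Hessian of the Lagrangian applied to ξ is −Y Yᵀ ξ + ξ λ. -/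
open Matrix

attribute [local instance] Matrix.frobeniusNormedAddCommGroup Matrix.frobeniusNormedSpace

section QuadraticFunction

variable {E : Type*} [NormedAddCommGroup E] [NormedSpace ℝ E]

theorem hasFDerivAt_half_quadratic_add_const (B : E →L[ℝ] E →L[ℝ] ℝ)
    (hB : ∀ x y, B x y = B y x) (c : ℝ) (x : E) :
    HasFDerivAt (fun y => (1 / 2 : ℝ) * B y y + c) (B x) x := by
  have h := ((B.hasFDerivAt_of_bilinear (hasFDerivAt_id x) (hasFDerivAt_id x)).const_mul
    (1 / 2 : ℝ)).add_const c
  refine h.congr_fderiv (ContinuousLinearMap.ext fun y => ?_)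
  simp [hB y x]
  ring

theorem contDiff_half_quadratic_add_const (B : E →L[ℝ] E →L[ℝ] ℝ) (c : ℝ) {k : WithTop ℕ∞} :
    ContDiff ℝ k (fun y => (1 / 2 : ℝ) * B y y + c) :=
  (contDiff_const.mul (B.contDiff.clm_apply contDiff_id)).add contDiff_const

theorem fderiv_fderiv_half_quadratic_add_const (B : E →L[ℝ] E →L[ℝ] ℝ)
    (hB : ∀ x y, B x y = B y x) (c : ℝ) (x v : E) :
    fderiv ℝ (fun z => fderiv ℝ (fun y => (1 / 2 : ℝ) * B y y + c) z v) x v = B v v := by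
  have h : (fun z => fderiv ℝ (fun y => (1 / 2 : ℝ) * B y y + c) z v) = B v := by
    ext z
    rw [(hasFDerivAt_half_quadratic_add_const B hB c z).fderiv, hB]
  rw [h, ContinuousLinearMap.fderiv]

end QuadraticFunction

/-- The bilinear form `(U, V) ↦ ⟨U, -Y Yᵀ V + V l⟩`, the Hessian of the Lagrangian. -/
noncomputable def lagrangianHessian {n r m : ℕ} (Y : Matrix (Fin n) (Fin m) ℝ)
    (l : Matrix (Fin r) (Fin r) ℝ) :
    Matrix (Fin n) (Fin r) ℝ →L[ℝ] Matrix (Fin n) (Fin r) ℝ →L[ℝ] ℝ :=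
  LinearMap.toContinuousBilinearMap <|
    LinearMap.mk₂ ℝ (fun U V => trace (Uᵀ * (-(Y * Yᵀ * V) + V * l)))
      (fun U U' V => by simp only [transpose_add, Matrix.add_mul, trace_add])
      (fun a U V => by simp only [transpose_smul, Matrix.smul_mul, trace_smul])
      (fun U V V' => by
        simp only [Matrix.mul_add, Matrix.add_mul, Matrix.mul_neg, trace_add, trace_neg]; ring)
      (fun a U V => by
        simp only [Matrix.mul_add, Matrix.mul_smul, Matrix.smul_mul, Matrix.mul_neg, trace_add,
          trace_neg, trace_smul, smul_eq_mul]; ring)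

theorem lagrangianHessian_apply {n r m : ℕ} (Y : Matrix (Fin n) (Fin m) ℝ)
    (l : Matrix (Fin r) (Fin r) ℝ) (U V : Matrix (Fin n) (Fin r) ℝ) :
    lagrangianHessian Y l U V = trace (Uᵀ * (-(Y * Yᵀ * V) + V * l)) :=
  rfl

theorem lagrangianHessian_comm {n r m : ℕ} (Y : Matrix (Fin n) (Fin m) ℝ)
    (l : Matrix (Fin r) (Fin r) ℝ) (hl : lᵀ = l) (U V : Matrix (Fin n) (Fin r) ℝ) :
    lagrangianHessian Y l U V = lagrangianHessian Y l V U := by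
  rw [lagrangianHessian_apply, lagrangianHessian_apply, ← trace_transpose]
  simp only [transpose_mul, transpose_add, transpose_neg, transpose_transpose, hl,
    Matrix.mul_add, Matrix.mul_neg, trace_add, trace_neg]
  rw [Matrix.mul_assoc l, trace_mul_comm l]
  simp only [Matrix.mul_assoc]

/-- The Lagrangian `L(U) = −(1/2)Tr(YᵀUUᵀY) + (1/2)Tr(λ(UᵀU − I))` with
symmetric `λ` is twice differentiable and its second derivative at `U`
evaluated at `(ξ, ξ)` equals `⟨ξ, −YYᵀξ + ξλ⟩`. -/
theorem stmt_6 {n r m : ℕ} (Y : Matrix (Fin n) (Fin m) ℝ)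
    (l : Matrix (Fin r) (Fin r) ℝ) (hl : lᵀ = l)
    (L : Matrix (Fin n) (Fin r) ℝ → ℝ)
    (hL : L = fun U =>
      -(1 / 2 : ℝ) * trace (Yᵀ * U * Uᵀ * Y) + (1 / 2 : ℝ) * trace (l * (Uᵀ * U - 1))) :
    ContDiff ℝ 2 L ∧
    ∀ (U ξ : Matrix (Fin n) (Fin r) ℝ),
      fderiv ℝ (fun V => fderiv ℝ L V ξ) U ξ =
        trace (ξᵀ * (-(Y * Yᵀ * ξ) + ξ * l)) := by
  have hLB : L = fun U => (1 / 2 : ℝ) * lagrangianHessian Y l U U + -(1 / 2 : ℝ) * trace l := by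
    rw [hL]
    funext U
    have h₁ : trace (Yᵀ * U * Uᵀ * Y) = trace (Uᵀ * (Y * Yᵀ * U)) := by
      rw [Matrix.mul_assoc (Yᵀ * U), trace_mul_comm]
      simp only [Matrix.mul_assoc]
    have h₂ : trace (l * (Uᵀ * U)) = trace (Uᵀ * (U * l)) := by
      rw [trace_mul_comm, Matrix.mul_assoc]
    rw [lagrangianHessian_apply, h₁, Matrix.mul_sub, Matrix.mul_one, trace_sub, h₂,
      Matrix.mul_add, Matrix.mul_neg, trace_add, trace_neg]
    ring
  rw [hLB]
  refine ⟨contDiff_half_quadratic_add_const _ _, fun U ξ => ?_⟩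
  exact fderiv_fderiv_half_quadratic_add_const _ (lagrangianHessian_comm Y l hl) _ U ξ
end

section
/- Let U be a real n×r matrix with UᵀU = I_r, let λ be a symmetric invertible real r×r matrix, let G be a real n×r matrix, and let S be a symmetric r×r matrix satisfying the Lyapunov equation λ S + S λ = λ (Uᵀ G + Gᵀ U) λ. Then the matrix ξ := G − U S λ^{-1} satisfies Uᵀ ξ + ξᵀ U = 0, i.e., ξ lies in the tangent space to the Stiefel manifold at U; hence ξ is the projection of G onto the tangent space with respect to the metric ⟨ξ, η⟩ = Tr(ξᵀ η λ). -/
open Matrix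

/-- If `S` solves the Lyapunov equation `λS + Sλ = λ(UᵀG + GᵀU)λ`, then
`ξ = G − USλ⁻¹` is tangent to the Stiefel manifold at `U`: `Uᵀξ + ξᵀU = 0`. -/
theorem stmt_10 {n r : ℕ} (U : Matrix (Fin n) (Fin r) ℝ) (hU : Uᵀ * U = 1)
    (l : Matrix (Fin r) (Fin r) ℝ) (hsym : lᵀ = l) (hinv : IsUnit l.det)
    (G : Matrix (Fin n) (Fin r) ℝ) (S : Matrix (Fin r) (Fin r) ℝ) (hS : Sᵀ = S)
    (hLyap : l * S + S * l = l * (Uᵀ * G + Gᵀ * U) * l) :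
    Uᵀ * (G - U * S * l⁻¹) + (G - U * S * l⁻¹)ᵀ * U = 0 := by
  have hl : l⁻¹ * l = 1 := nonsing_inv_mul l hinv
  have hr : l * l⁻¹ = 1 := mul_nonsing_inv l hinv
  have key : Uᵀ * G + Gᵀ * U = S * l⁻¹ + l⁻¹ * S :=
    calc Uᵀ * G + Gᵀ * U = (l⁻¹ * l) * (Uᵀ * G + Gᵀ * U) * (l * l⁻¹) := by
          rw [hl, hr, Matrix.one_mul, Matrix.mul_one]
      _ = l⁻¹ * (l * (Uᵀ * G + Gᵀ * U) * l) * l⁻¹ := by simp only [Matrix.mul_assoc]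
      _ = (l⁻¹ * l) * S * l⁻¹ + l⁻¹ * S * (l * l⁻¹) := by
          rw [← hLyap]; simp only [Matrix.mul_add, Matrix.add_mul, Matrix.mul_assoc]
      _ = S * l⁻¹ + l⁻¹ * S := by rw [hl, hr, Matrix.one_mul, Matrix.mul_one]
  have hleft : Uᵀ * (U * S * l⁻¹) = S * l⁻¹ := by
    rw [Matrix.mul_assoc U, ← Matrix.mul_assoc, hU, Matrix.one_mul]
  have hright : (U * S * l⁻¹)ᵀ * U = l⁻¹ * S := by
    rw [transpose_mul, transpose_mul, transpose_nonsing_inv, hsym, hS, Matrix.mul_assoc,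
      Matrix.mul_assoc, hU, Matrix.mul_one]
  rw [transpose_sub, Matrix.mul_sub, Matrix.sub_mul, hleft, hright, sub_add_sub_comm, key,
    sub_self]
end

section
/- Let U be a real n×r matrix with UᵀU = I_r, let Y be a real n×m matrix, and suppose λ := Uᵀ Y Yᵀ U is invertible. Define ξ := −Y Yᵀ U λ^{-1} + U. Then: (i) Uᵀ ξ = 0, so in particular Uᵀξ + ξᵀU = 0 (ξ is tangent, indeed horizontal, at U); and (ii) for every η ∈ ℝ^{n×r} with Uᵀη + ηᵀU = 0, one has Tr(ξᵀ η λ) = Tr((−Y Yᵀ U)ᵀ η). Hence ξ is the Riemannian gradient of f(U) = −(1/2)‖UᵀY‖_F² at U with respect to the preconditioned metric ⟨ξ, η⟩_U := Tr(ξᵀ η λ). -/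
open Matrix

/-- The product of a symmetric and a skew-symmetric real matrix has trace zero. -/
theorem Matrix.IsSymm.trace_mul_eq_zero_of_skew {ι : Type*} [Fintype ι]
    {A B : Matrix ι ι ℝ} (hA : A.IsSymm) (hB : B + Bᵀ = 0) : trace (A * B) = 0 := by
  have h : trace (A * B) = trace (A * Bᵀ) := by
    rw [← trace_transpose, transpose_mul, hA.eq, trace_mul_comm]
  rw [eq_neg_of_add_eq_zero_right hB, mul_neg, trace_neg] at h
  linarith

/-- With `λ = UᵀYYᵀU` invertible, `ξ = −YYᵀUλ⁻¹ + U` satisfies `Uᵀξ = 0`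
(hence is tangent at `U`), and for every tangent `η`,
`Tr(ξᵀ η λ) = Tr((−YYᵀU)ᵀ η)`; i.e. `ξ` is the Riemannian gradient of
`f(U) = −(1/2)‖UᵀY‖_F²` under the preconditioned metric. -/
theorem stmt_11 {n r m : ℕ} (U : Matrix (Fin n) (Fin r) ℝ) (Y : Matrix (Fin n) (Fin m) ℝ)
    (hU : Uᵀ * U = 1) (l : Matrix (Fin r) (Fin r) ℝ) (hl : l = Uᵀ * Y * Yᵀ * U)
    (hinv : IsUnit l.det) (ξ : Matrix (Fin n) (Fin r) ℝ)
    (hxi : ξ = -(Y * Yᵀ * U * l⁻¹) + U) :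
    Uᵀ * ξ = 0 ∧ Uᵀ * ξ + ξᵀ * U = 0 ∧
    ∀ η : Matrix (Fin n) (Fin r) ℝ, Uᵀ * η + ηᵀ * U = 0 →
      trace (ξᵀ * η * l) = trace ((-(Y * Yᵀ * U))ᵀ * η) := by
  have hsymm : l.IsSymm := by
    simp [Matrix.IsSymm, hl, transpose_mul, Matrix.mul_assoc]
  have horth : Uᵀ * ξ = 0 := by
    have h : Uᵀ * (Y * Yᵀ * U * l⁻¹) = 1 := by
      rw [← mul_nonsing_inv l hinv]
      nth_rw 2 [hl]
      simp only [Matrix.mul_assoc]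
    rw [hxi, Matrix.mul_add, Matrix.mul_neg, h, hU, neg_add_cancel]
  refine ⟨horth, ?_, fun η hη => ?_⟩
  · have h : ξᵀ * U = 0 := by simpa using congrArg transpose horth
    rw [horth, h, add_zero]
  · have hξl : ξ * l = -(Y * Yᵀ * U) + U * l := by
      rw [hxi, Matrix.add_mul, Matrix.neg_mul, nonsing_inv_mul_cancel_right _ _ hinv]
    have hlξ : l * ξᵀ = (-(Y * Yᵀ * U))ᵀ + l * Uᵀ := by
      simpa only [transpose_add, transpose_mul, hsymm.eq] using congrArg transpose hξl
    have hskew : trace (l * (Uᵀ * η)) = 0 :=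
      hsymm.trace_mul_eq_zero_of_skew (by simpa using hη)
    rw [trace_mul_comm, ← Matrix.mul_assoc, hlξ, Matrix.add_mul, trace_add,
      Matrix.mul_assoc l, hskew, add_zero]
end

section
/- Let V be a real inner product space, m a positive integer, C ≥ 0, and let a_1, …, a_m and b_1, …, b_m be vectors in V such that ‖a_i − b_i‖² ≤ C ∑_{j=1}^{i−1} ‖b_j‖² for every i = 1, …, m. Then ∑_{i=1}^m ‖a_i‖² ≤ 2(1 + C m) ∑_{i=1}^m ‖b_i‖². -/
/-- In a real inner product space, if `‖a i − b i‖² ≤ C ∑_{j < i} ‖b j‖²` for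
each `i`, then `∑ i ‖a i‖² ≤ 2(1 + C m) ∑ i ‖b i‖²`. -/
theorem stmt_15 {V : Type*} [NormedAddCommGroup V] [InnerProductSpace ℝ V]
    (m : ℕ) (hm : 0 < m) (C : ℝ) (hC : 0 ≤ C) (a b : Fin m → V)
    (h : ∀ i : Fin m, ‖a i - b i‖ ^ 2 ≤ C * ∑ j ∈ Finset.Iio i, ‖b j‖ ^ 2) :
    ∑ i, ‖a i‖ ^ 2 ≤ 2 * (1 + C * m) * ∑ i, ‖b i‖ ^ 2 := by
  have key (i : Fin m) : ‖a i‖ ^ 2 ≤ 2 * ‖b i‖ ^ 2 + 2 * (C * ∑ j, ‖b j‖ ^ 2) := by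
    have htri : ‖a i‖ ≤ ‖b i‖ + ‖a i - b i‖ := by
      simpa using norm_add_le (b i) (a i - b i)
    have hsum : C * ∑ j ∈ Finset.Iio i, ‖b j‖ ^ 2 ≤ C * ∑ j, ‖b j‖ ^ 2 :=
      mul_le_mul_of_nonneg_left
        (Finset.sum_le_sum_of_subset_of_nonneg (Finset.subset_univ _)
          fun _ _ _ => by positivity) hC
    calc ‖a i‖ ^ 2 ≤ (‖b i‖ + ‖a i - b i‖) ^ 2 := by gcongr
      _ ≤ 2 * (‖b i‖ ^ 2 + ‖a i - b i‖ ^ 2) := add_sq_le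
      _ ≤ 2 * ‖b i‖ ^ 2 + 2 * (C * ∑ j, ‖b j‖ ^ 2) := by linarith [h i]
  calc ∑ i, ‖a i‖ ^ 2 ≤ ∑ i, (2 * ‖b i‖ ^ 2 + 2 * (C * ∑ j, ‖b j‖ ^ 2)) :=
        Finset.sum_le_sum fun i _ => key i
    _ = 2 * (1 + C * m) * ∑ i, ‖b i‖ ^ 2 := by
        rw [Finset.sum_add_distrib, ← Finset.mul_sum, Finset.sum_const, Finset.card_univ,
          Fintype.card_fin, nsmul_eq_mul]
        ring
end
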